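/- Unimodal property of the one-sided case (Lemma 8 of the paper): assume additionally x_1 < x_2 < ⋯ < x_n, and let m* be the smallest index in [j₀, n] such that D(m*) = min_{j₀ ≤ j ≤ n} D(j), where j₀ := max(m, ⌈β/(2z)⌉). Then D(j−1) > D(j) for every j with j₀ < j ≤ m*; D(m*) ≤ D(m*+1) when m* < n; and D(j−1) < D(j) for every j with m* + 2 ≤ j ≤ n. In other words, as j increases from j₀ to n the value D(j) first strictly decreases until D(m*) and then strictly increases, except that D(m*) = D(m*+1) may be possible. -/

import Mathlib

/-- A configuration `y` of the `n` sensors (with covering range `z`) covers the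
barrier `[0, β]`. -/
def Covers (n : ℕ) (z β : ℝ) (y : ℕ → ℝ) : Prop :=
  Set.Icc (0 : ℝ) β ⊆ ⋃ i ∈ Finset.Icc 1 n, Set.Icc (y i - z) (y i + z)

/-- The cost of moving the sensors from positions `x` to positions `y`. -/
noncomputable def Cost (n : ℕ) (x y : ℕ → ℝ) : ℝ :=
  ∑ i ∈ Finset.Icc 1 n, |x i - y i|

/-- The optimal (infimum) cost over all covering configurations. -/
noncomputable def OptCost (n : ℕ) (z β : ℝ) (x : ℕ → ℝ) : ℝ :=
  sInf {c : ℝ | ∃ y : ℕ → ℝ, Covers n z β y ∧ c = Cost n x y}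

/-- One-sided case: the optimal cost `OptC(j)` of the containing-case instance on the
first `j` sensors, where sensors `m+1, …, j` have been moved to `β + z`. -/
noncomputable def OptC (m : ℕ) (z β : ℝ) (x : ℕ → ℝ) (j : ℕ) : ℝ :=
  sInf {c : ℝ | ∃ y : ℕ → ℝ, Covers j z β y ∧
    c = ∑ i ∈ Finset.Icc 1 j, |(if i ≤ m then x i else β + z) - y i|}

/-- `D(j)`: the cost of moving sensors `m+1, …, j` leftwards to `β + z` plus the
optimal cost of the resulting containing-case instance on the first `j` sensors. -/
noncomputable def DVal (m : ℕ) (z β : ℝ) (x : ℕ → ℝ) (j : ℕ) : ℝ :=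
  (∑ i ∈ Finset.Icc (m + 1) j, (x i - z - β)) + OptC m z β x j


/-- Matching two pairs of reals in increasing order does not increase the total distance. -/
theorem abs_sub_add_abs_sub_le_swap {a b c d : ℝ} (hab : a ≤ b) (hcd : c ≤ d) :
    |a - c| + |b - d| ≤ |a - d| + |b - c| := by
  grind

/-- Matching a monotone family `p` with the values of `y` in increasing order does not
increase the total distance. The monotone weight `w` is only used to break ties. -/
theorem exists_perm_monotone_sum_abs_sub_le {ι : Type*} [Fintype ι] [LinearOrder ι]
    (w p y : ι → ℝ) (hw : StrictMono w) (hp : Monotone p) :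
    ∃ σ : Equiv.Perm ι, Monotone (y ∘ σ) ∧
      ∑ i, |p i - y (σ i)| ≤ ∑ i, |p i - y i| := by
  classical
  obtain ⟨σ, hσ, hmax⟩ := Finset.exists_max_image
    (Finset.univ.filter fun σ : Equiv.Perm ι => ∑ i, |p i - y (σ i)| ≤ ∑ i, |p i - y i|)
    (fun σ => ∑ i, w i * y (σ i)) ⟨1, by simp⟩
  simp only [Finset.mem_filter, Finset.mem_univ, true_and] at hσ hmax
  refine ⟨σ, fun a b hab => ?_, hσ⟩
  by_contra! hlt
  simp only [Function.comp_apply] at hlt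
  have hne : a ≠ b := by rintro rfl; exact lt_irrefl _ hlt
  have hab' : a < b := lt_of_le_of_ne hab hne
  have sum_swap : ∀ f : ι → ℝ → ℝ,
      ∑ i, f i (y ((σ * Equiv.swap a b) i)) - ∑ i, f i (y (σ i)) =
        (f a (y (σ b)) - f a (y (σ a))) + (f b (y (σ a)) - f b (y (σ b))) := by
    intro f
    rw [← Finset.sum_sub_distrib, Fintype.sum_eq_add a b hne]
    · simp
    · rintro c ⟨hca, hcb⟩
      simp [Equiv.swap_apply_of_ne_of_ne hca hcb]
  have hcost := sum_swap fun i t => |p i - t|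
  have hweight := sum_swap fun i t => w i * t
  have hexch : |p a - y (σ b)| + |p b - y (σ a)| ≤ |p a - y (σ a)| + |p b - y (σ b)| :=
    abs_sub_add_abs_sub_le_swap (hp hab) hlt.le
  have := hmax (σ * Equiv.swap a b) (by linarith)
  nlinarith [mul_pos (sub_pos.2 (hw hab')) (sub_pos.2 hlt)]

/-- The configuration `y` covers `[0, β]` from left to right, in the order of the indices. -/
def IsCoveringChain (j : ℕ) (z β : ℝ) (y : ℕ → ℝ) : Prop :=
  y 1 ≤ z ∧ (∀ i, 1 ≤ i → i < j → y (i + 1) ≤ y i + 2 * z) ∧ β - z ≤ y j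

theorem covers_iff (j : ℕ) (z β : ℝ) (y : ℕ → ℝ) :
    Covers j z β y ↔
      ∀ t, 0 ≤ t → t ≤ β → ∃ i, 1 ≤ i ∧ i ≤ j ∧ y i - z ≤ t ∧ t ≤ y i + z := by
  simp only [Covers, Set.subset_def, Set.mem_iUnion, Set.mem_Icc, Finset.mem_Icc, exists_prop,
    and_imp, and_assoc]

theorem IsCoveringChain.covers {j : ℕ} {z β : ℝ} {y : ℕ → ℝ} (hj : 1 ≤ j) (h : IsCoveringChain j z β y) :
    Covers j z β y := by
  classical
  obtain ⟨h1, hstep, hlast⟩ := h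
  rw [covers_iff]
  intro t ht0 htβ
  have hex : ∃ i, 1 ≤ i ∧ t ≤ y i + z := ⟨j, hj, by linarith⟩
  obtain ⟨hi1, hit⟩ := Nat.find_spec hex
  have hij : Nat.find hex ≤ j := Nat.find_min' hex ⟨hj, by linarith⟩
  have hmin := fun k (hk : k < Nat.find hex) => Nat.find_min hex hk
  generalize Nat.find hex = i at *
  refine ⟨i, hi1, hij, ?_, hit⟩
  rcases Nat.eq_or_lt_of_le hi1 with rfl | hlt
  · linarith
  · obtain ⟨k, rfl⟩ : ∃ k, i = k + 1 := ⟨i - 1, by omega⟩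
    have hk := hmin k (by omega)
    have hs := hstep k (by omega) (by omega)
    have : ¬ t ≤ y k + z := fun hc => hk ⟨by omega, hc⟩
    linarith

/-- Clamping a sorted covering configuration to `[-z, β + z]` gives a chain. -/
theorem Covers.isCoveringChain_clamp {j : ℕ} {z β : ℝ} {v : ℕ → ℝ} (hz : 0 < z) (hβ : 0 < β)
    (hcov : Covers j z β v) (hv : ∀ a b, 1 ≤ a → a ≤ b → b ≤ j → v a ≤ v b) :
    IsCoveringChain j z β fun i => max (-z) (min (v i) (β + z)) := by
  rw [covers_iff] at hcov
  refine ⟨?_, fun i hi hij => ?_, ?_⟩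
  · obtain ⟨i, hi1, hij, hl, -⟩ := hcov 0 le_rfl hβ.le
    have := hv 1 i le_rfl hi1 hij
    exact max_le (by linarith) (min_le_of_left_le (by linarith))
  · by_contra! hgap
    obtain ⟨k, hk1, hkj, hl, hr⟩ := hcov
      ((max (-z) (min (v i) (β + z)) + max (-z) (min (v (i + 1)) (β + z))) / 2)
      (by grind) (by grind)
    rcases Nat.lt_or_ge i k with hik | hki
    · have := hv (i + 1) k (by omega) hik hkj
      grind
    · have := hv k i hk1 hki hij.le
      grind
  · obtain ⟨i, hi1, hij, -, hr⟩ := hcov β hβ.le le_rfl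
    have := hv i j hi1 hij le_rfl
    exact le_max_of_le_right (le_min (by linarith) (by linarith))

/-- If the initial positions are sorted and lie in `[-z, β + z]`, every covering configuration
can be replaced by a chain of no larger cost. -/
theorem Covers.exists_isCoveringChain {j : ℕ} {z β : ℝ} {p y : ℕ → ℝ} (hz : 0 < z) (hβ : 0 < β)
    (hp : ∀ a b, 1 ≤ a → a ≤ b → b ≤ j → p a ≤ p b)
    (hpl : ∀ i, 1 ≤ i → i ≤ j → -z ≤ p i) (hpr : ∀ i, 1 ≤ i → i ≤ j → p i ≤ β + z)
    (hcov : Covers j z β y) :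
    ∃ u, IsCoveringChain j z β u ∧ Cost j p u ≤ Cost j p y := by
  classical
  obtain ⟨σ, hmono, hle⟩ := exists_perm_monotone_sum_abs_sub_le
    (ι := Finset.Icc 1 j) (fun i => ((i : ℕ) : ℝ)) (fun i => p i) (fun i => y i)
    (fun a b hab => Nat.cast_lt.2 hab)
    (fun a b hab => hp a b (Finset.mem_Icc.1 a.2).1 hab (Finset.mem_Icc.1 b.2).2)
  let v : ℕ → ℝ := fun i => if h : i ∈ Finset.Icc 1 j then y (σ ⟨i, h⟩) else 0
  have hvσ : ∀ i : Finset.Icc 1 j, v i = y (σ i) := fun i => by simp only [v, dif_pos i.2]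
  have hv : ∀ a b, 1 ≤ a → a ≤ b → b ≤ j → v a ≤ v b := by
    intro a b ha hab hb
    have ha' : a ∈ Finset.Icc 1 j := Finset.mem_Icc.2 ⟨ha, hab.trans hb⟩
    have hb' : b ∈ Finset.Icc 1 j := Finset.mem_Icc.2 ⟨ha.trans hab, hb⟩
    have hab' := @hmono ⟨a, ha'⟩ ⟨b, hb'⟩ hab
    exact (hvσ ⟨a, ha'⟩).trans_le (hab'.trans_eq (hvσ ⟨b, hb'⟩).symm)
  have hvcov : Covers j z β v := by
    rw [covers_iff] at hcov ⊢
    intro t ht0 htβ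
    obtain ⟨i, hi1, hij, hit⟩ := hcov t ht0 htβ
    have hmem : i ∈ Finset.Icc 1 j := Finset.mem_Icc.2 ⟨hi1, hij⟩
    have hk := Finset.mem_Icc.1 (σ.symm ⟨i, hmem⟩).2
    refine ⟨σ.symm ⟨i, hmem⟩, hk.1, hk.2, ?_⟩
    rw [hvσ, Equiv.apply_symm_apply]
    exact hit
  have hcost : Cost j p v ≤ Cost j p y := by
    unfold Cost
    rw [← Finset.sum_coe_sort, ← Finset.sum_coe_sort (Finset.Icc 1 j) fun i => |p i - y i|]
    simpa only [hvσ] using hle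
  refine ⟨_, hvcov.isCoveringChain_clamp hz hβ hv, le_trans (Finset.sum_le_sum fun i hi => ?_) hcost⟩
  obtain ⟨hi1, hij⟩ := Finset.mem_Icc.1 hi
  have := hpl i hi1 hij
  have := hpr i hi1 hij
  grind

/-- Averaging a chain of length `k` (extended by a sensor at `β + z`) with a chain of length
`k + 2` gives a chain of length `k + 1`. -/
theorem exists_isCoveringChain_average {k : ℕ} {z β : ℝ} {p u u' : ℕ → ℝ} (hk : 1 ≤ k)
    (hpk : p (k + 1) = β + z) (hu : IsCoveringChain k z β u) (hu' : IsCoveringChain (k + 2) z β u') :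
    ∃ w, IsCoveringChain (k + 1) z β w ∧ 2 * Cost (k + 1) p w ≤ Cost k p u + Cost (k + 2) p u' := by
  obtain ⟨h1, hs, hl⟩ := hu
  obtain ⟨h1', hs', hl'⟩ := hu'
  refine ⟨fun i => ((if i ≤ k then u i else β + z) + u' i) / 2, ⟨?_, fun i hi hik => ?_, ?_⟩, ?_⟩
  · simp only [if_pos hk]
    linarith
  · have h' := hs' i hi (by omega)
    simp only [if_pos (Nat.lt_succ_iff.1 hik)]
    split_ifs with hik'
    · linarith [hs i hi hik']
    · obtain rfl : i = k := by omega
      linarith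
  · have := hs' (k + 1) (by omega) (by omega)
    simp only [Nat.not_succ_le_self, if_false]
    linarith
  · unfold Cost
    rw [Finset.sum_Icc_succ_top (by omega), Finset.sum_Icc_succ_top (b := k + 1) (by omega),
      Finset.sum_Icc_succ_top (b := k) (by omega)]
    have hsum : 2 * ∑ i ∈ Finset.Icc 1 k, |p i - ((if i ≤ k then u i else β + z) + u' i) / 2| ≤
        ∑ i ∈ Finset.Icc 1 k, |p i - u i| + ∑ i ∈ Finset.Icc 1 k, |p i - u' i| := by
      rw [Finset.mul_sum, ← Finset.sum_add_distrib]
      refine Finset.sum_le_sum fun i hi => ?_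
      rw [if_pos (Finset.mem_Icc.1 hi).2]
      grind
    have hlast : 2 * |p (k + 1) -
        ((if k + 1 ≤ k then u (k + 1) else β + z) + u' (k + 1)) / 2| ≤
        |p (k + 1) - u' (k + 1)| := by
      rw [if_neg (by omega), hpk]
      grind
    have := abs_nonneg (p (k + 1 + 1) - u' (k + 1 + 1))
    linarith

theorem exists_covers {j : ℕ} {z β : ℝ} (hj : 1 ≤ j) (hfeas : β ≤ 2 * z * j) :
    ∃ y, Covers j z β y := by
  refine ⟨fun i => (2 * i - 1) * z, IsCoveringChain.covers hj ⟨?_, fun i _ _ => ?_, ?_⟩⟩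
  · norm_num
  · push_cast
    linarith
  · simp only
    linarith

/-- Discrete convexity of `OptCost` in the number of sensors at `β + z`. -/
theorem two_mul_optCost_le {k : ℕ} {z β : ℝ} {p : ℕ → ℝ} (hz : 0 < z) (hβ : 0 < β) (hk : 1 ≤ k)
    (hfeas : β ≤ 2 * z * k) (hp : ∀ a b, 1 ≤ a → a ≤ b → b ≤ k + 2 → p a ≤ p b)
    (hpl : ∀ i, 1 ≤ i → i ≤ k + 2 → -z ≤ p i) (hpr : ∀ i, 1 ≤ i → i ≤ k + 2 → p i ≤ β + z)
    (hpk : p (k + 1) = β + z) :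
    2 * OptCost (k + 1) z β p ≤ OptCost k z β p + OptCost (k + 2) z β p := by
  have hbdd : BddBelow {c : ℝ | ∃ y, Covers (k + 1) z β y ∧ c = Cost (k + 1) p y} := by
    refine ⟨0, ?_⟩
    rintro _ ⟨y, -, rfl⟩
    exact Finset.sum_nonneg fun i _ => abs_nonneg _
  have hmain : ∀ y y', Covers k z β y → Covers (k + 2) z β y' →
      2 * OptCost (k + 1) z β p ≤ Cost k p y + Cost (k + 2) p y' := by
    intro y y' hy hy'
    obtain ⟨u, hu, huc⟩ := hy.exists_isCoveringChain hz hβ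
      (fun a b ha hab hb => hp a b ha hab (by omega))
      (fun i hi hik => hpl i hi (by omega)) (fun i hi hik => hpr i hi (by omega))
    obtain ⟨u', hu', huc'⟩ := hy'.exists_isCoveringChain hz hβ hp hpl hpr
    obtain ⟨w, hw, hwc⟩ := exists_isCoveringChain_average hk hpk hu hu'
    have := csInf_le hbdd ⟨w, hw.covers (by omega), rfl⟩
    unfold OptCost
    linarith
  obtain ⟨y₀, hy₀⟩ := exists_covers hk hfeas
  obtain ⟨y₁, hy₁⟩ := exists_covers (j := k + 2) (z := z) (β := β) (by omega)
    (by push_cast; linarith)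
  have hle : 2 * OptCost (k + 1) z β p - OptCost (k + 2) z β p ≤ OptCost k z β p := by
    refine le_csInf ⟨_, y₀, hy₀, rfl⟩ ?_
    rintro _ ⟨y, hy, rfl⟩
    have : 2 * OptCost (k + 1) z β p - Cost k p y ≤ OptCost (k + 2) z β p := by
      refine le_csInf ⟨_, y₁, hy₁, rfl⟩ ?_
      rintro _ ⟨y', hy', rfl⟩
      linarith [hmain y y' hy hy']
    linarith
  linarith

/-- A strictly convex sequence is strictly decreasing up to its first minimizer and strictly
increasing from the successor of it. -/
theorem unimodal_of_strictly_convex {D : ℕ → ℝ} {a n s : ℕ}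
    (hconv : ∀ k, a ≤ k → k + 2 ≤ n → D (k + 1) - D k < D (k + 2) - D (k + 1))
    (has : a ≤ s) (hsn : s ≤ n) (hmin : ∀ j, a ≤ j → j ≤ n → D s ≤ D j)
    (hleast : ∀ j, a ≤ j → j < s → D s < D j) :
    (∀ j, a < j → j ≤ s → D (j - 1) > D j) ∧ (s < n → D s ≤ D (s + 1)) ∧
    (∀ j, s + 2 ≤ j → j ≤ n → D (j - 1) < D j) := by
  have hdiff : ∀ k, a ≤ k → ∀ l, k ≤ l → l + 1 ≤ n → D (k + 1) - D k ≤ D (l + 1) - D l := by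
    intro k hk l hkl
    induction l, hkl using Nat.le_induction with
    | base => exact fun _ => le_rfl
    | succ l hkl ih => exact fun hl => (ih (by omega)).trans (hconv l (by omega) hl).le
  refine ⟨fun j haj hjs => ?_, fun h => hmin _ (by omega) h, fun j hsj hjn => ?_⟩
  · obtain ⟨k, rfl⟩ : ∃ k, j = k + 1 := ⟨j - 1, by omega⟩
    obtain ⟨l, rfl⟩ : ∃ l, s = l + 1 := ⟨s - 1, by omega⟩
    have := hdiff k (by omega) l (by omega) hsn
    have := hleast l (by omega) (by omega)
    simp only [Nat.add_sub_cancel]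
    linarith
  · obtain ⟨k, rfl⟩ : ∃ k, j = k + 2 := ⟨j - 2, by omega⟩
    have := hdiff s has k (by omega) (by omega)
    have := hconv k (by omega) hjn
    have := hmin (s + 1) (by omega) (by omega)
    have hk : k + 2 - 1 = k + 1 := by omega
    rw [hk]
    linarith

/-- Lemma 8 (unimodal property of the one-sided case): assuming strictly increasing
input positions, with `j₀ = max(m, ⌈β/(2z)⌉)` and `m*` the smallest index in `[j₀, n]`
minimizing `D`, the value `D(j)` strictly decreases until `D(m*)`, satisfies
`D(m*) ≤ D(m*+1)`, and strictly increases for `j ≥ m* + 2`. -/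
theorem one_sided_unimodal
    (n : ℕ) (z β : ℝ) (x : ℕ → ℝ) (m j0 mstar : ℕ)
    (hn : 1 ≤ n) (hz : 0 < z) (hβ : 0 < β)
    (hsort : ∀ i, 1 ≤ i → i < n → x i < x (i + 1))
    (hx1l : -z ≤ x 1) (hx1r : x 1 - z ≤ β) (hfeas : β ≤ 2 * z * n)
    (hm1 : 1 ≤ m) (hmn : m < n)
    (hmle : x m - z ≤ β)
    (hmmax : ∀ i, m < i → i ≤ n → β < x i - z)
    (hj0 : j0 = max m ⌈β / (2 * z)⌉₊)
    (hstar1 : j0 ≤ mstar) (hstar2 : mstar ≤ n)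
    (hstarmin : ∀ j, j0 ≤ j → j ≤ n → DVal m z β x mstar ≤ DVal m z β x j)
    (hstarleast : ∀ j, j0 ≤ j → j < mstar → DVal m z β x mstar < DVal m z β x j) :
    (∀ j, j0 < j → j ≤ mstar → DVal m z β x (j - 1) > DVal m z β x j) ∧
    (mstar < n → DVal m z β x mstar ≤ DVal m z β x (mstar + 1)) ∧
    (∀ j, mstar + 2 ≤ j → j ≤ n → DVal m z β x (j - 1) < DVal m z β x j) := by
  have hx : ∀ a b, 1 ≤ a → a ≤ b → b ≤ n → x a ≤ x b := by
    intro a b ha hab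
    induction b, hab using Nat.le_induction with
    | base => exact fun _ => le_rfl
    | succ b hab ih => exact fun hb => (ih (by omega)).trans (hsort b (by omega) hb).le
  refine unimodal_of_strictly_convex (fun k hk hkn => ?_) hstar1 hstar2 hstarmin hstarleast
  subst hj0
  have hmk : m ≤ k := le_of_max_le_left hk
  have hfeas_k : β ≤ 2 * z * k := by
    have := (Nat.ceil_le.1 (le_of_max_le_right hk))
    rw [div_le_iff₀ (by positivity)] at this
    linarith
  have hconv : 2 * OptC m z β x (k + 1) ≤ OptC m z β x k + OptC m z β x (k + 2) := by
    refine two_mul_optCost_le (p := fun i => if i ≤ m then x i else β + z) hz hβ (by omega)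
      hfeas_k (fun a b ha hab hb => ?_) (fun i hi hik => ?_) (fun i hi hik => ?_)
      (if_neg (by omega))
    · split_ifs with h1 h2 h2
      · exact hx a b ha hab (by omega)
      · linarith [hx a m ha h1 hmn.le]
      · omega
      · exact le_rfl
    · split_ifs with h
      · linarith [hx 1 i le_rfl hi (by omega)]
      · linarith
    · split_ifs with h
      · linarith [hx i m hi h hmn.le]
      · exact le_rfl
  have hlt := hsort (k + 1) (by omega) (by omega)
  unfold DVal
  rw [Finset.sum_Icc_succ_top (b := k + 1) (by omega), Finset.sum_Icc_succ_top (b := k) (by omega)]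
  linarith
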